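/- For every finite list σ of rational items, each in the open interval (0, 1), there exist a natural number m (with m at most the length of σ) and a rational x with 1/2 ≤ x ≤ 1 such that the strategy DH₃ with advice parameters (m, x) covers at least (9/14)·OPT(σ) − 97/42 bins when serving σ, where OPT(σ) is the maximum number of covered bins over all partitions of the multiset of items of σ. -/

import Mathlib

/-- State of the `DH k` advice strategy. -/
structure DHState where
  /-- critical bins: (contains an item of size ≥ x, actual load, virtual load) -/
  crit : List (Bool × ℚ × ℚ)
  /-- the load of the active `t`-bin, for each type `t` -/
  bins : ℕ → ℚ
  /-- the load of the active small bin -/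
  small : ℚ
  /-- the number of closed covered bins -/
  count : ℕ

/-- Update the first element of a list satisfying `p` using `f`. -/
def updateFirst {α : Type*} (p : α → Bool) (f : α → α) : List α → List α
  | [] => []
  | a :: rest => if p a then f a :: rest else a :: updateFirst p f rest

/-- One step of the `DH k` strategy with advice threshold `x` on reading item `v`:
(1) if `v ≥ x` and some critical bin does not yet contain an item of size `≥ x`,
place `v` in the lowest-indexed such critical bin (actual load increases by `v`,
virtual load by `v − x`); (2) otherwise, if `1/k ≤ v`, add `v` to the active bin
of its type `t = ⌈1/v⌉` (where `1/t ≤ v < 1/(t-1)`), closing it as covered when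
its load reaches `1`; (3) if `v < 1/k` and some critical bin has virtual load
`< 1`, place `v` in the lowest-indexed such critical bin (both loads increase by
`v`); otherwise add `v` to the active small bin, closing it as covered when its
load reaches `1`. -/
def dhStep (k : ℕ) (x : ℚ) (st : DHState) (v : ℚ) : DHState :=
  if x ≤ v ∧ (st.crit.any fun c => !c.1) then
    { st with crit := updateFirst (fun c => !c.1)
                  (fun c => (true, c.2.1 + v, c.2.2 + (v - x))) st.crit }
  else if (1 : ℚ) / k ≤ v then
    let t : ℕ := ⌈(1 : ℚ) / v⌉.toNat
    if 1 ≤ st.bins t + v then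
      { st with bins := Function.update st.bins t 0, count := st.count + 1 }
    else
      { st with bins := Function.update st.bins t (st.bins t + v) }
  else if st.crit.any fun c => decide (c.2.2 < 1) then
    { st with crit := updateFirst (fun c => decide (c.2.2 < 1))
                  (fun c => (c.1, c.2.1 + v, c.2.2 + v)) st.crit }
  else if 1 ≤ st.small + v then
    { st with small := 0, count := st.count + 1 }
  else
    { st with small := st.small + v }

/-- The number of bins covered by the strategy `DH k` with advice `(m, x)` on the
input list `σ`: it starts with `m` critical bins (actual load `0`, virtual load
`x`, containing no item of size `≥ x`), empty active `t`-bins and small bin and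
count `0`, processes `σ`, and finally counts the closed covered bins together
with the critical bins whose actual load is at least `1`. -/
def DH (k m : ℕ) (x : ℚ) (σ : List ℚ) : ℕ :=
  let st := σ.foldl (dhStep k x)
    ⟨List.replicate m (false, (0 : ℚ), x), fun _ => 0, 0, 0⟩
  st.count + st.crit.countP fun c => decide (1 ≤ c.2.1)

/-- The number of covered bins in a partition of a multiset of rationals. -/
def coveredCount (P : Multiset (Multiset ℚ)) : ℕ :=
  (P.filter fun B => 1 ≤ B.sum).card

/-- An upper bound for the total size of the small items in the critical bin `b`, when the item that
fills it up contributes at most `e`. -/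
def critBound (x e : ℚ) (b : Bool × ℚ × ℚ) : ℚ := if b.2.2 < 1 then b.2.2 - x else 1 - x + e

/-- The weight of an item: `1/2` and `1/3` for `2`-items and `3`-items, and `κ` times the size for
small items. -/
def itemWeight (κ v : ℚ) : ℚ := if 1 / 2 ≤ v then 1 / 2 else if 1 / 3 ≤ v then 1 / 3 else κ * v

/-- The size of a small item truncated at `c`; items that are not small count `0`. -/
def truncSize (c v : ℚ) : ℚ := if v < 1 / 3 then min v c else 0

theorem updateFirst_eq_append {α : Type*} (p : α → Bool) (f : α → α) (l : List α)
    (h : l.any p = true) :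
    ∃ l₁ a l₂, l = l₁ ++ a :: l₂ ∧ p a = true ∧ updateFirst p f l = l₁ ++ f a :: l₂ := by
  induction l with
  | nil => simp at h
  | cons b l ih =>
    by_cases hb : p b = true
    · exact ⟨[], b, l, rfl, hb, by simp [updateFirst, hb]⟩
    · have h' : l.any p = true := by simpa [hb] using h
      obtain ⟨l₁, a, l₂, h₁, h₂, h₃⟩ := ih h'
      exact ⟨b :: l₁, a, l₂, by simp [h₁], h₂, by simp [updateFirst, hb, h₃]⟩

theorem toNat_ceil_two {v : ℚ} (h : 1 / 2 ≤ v) (h' : v < 1) : ⌈(1 : ℚ) / v⌉.toNat = 2 := by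
  have hv : 0 < v := by linarith
  have : ⌈(1 : ℚ) / v⌉ = 2 := by
    rw [Int.ceil_eq_iff]
    constructor
    · rw [lt_div_iff₀ hv]; push_cast; linarith
    · rw [div_le_iff₀ hv]; push_cast; linarith
  rw [this]; rfl

theorem toNat_ceil_three {v : ℚ} (h : 1 / 3 ≤ v) (h' : v < 1 / 2) :
    ⌈(1 : ℚ) / v⌉.toNat = 3 := by
  have hv : 0 < v := by linarith
  have : ⌈(1 : ℚ) / v⌉ = 3 := by
    rw [Int.ceil_eq_iff]
    constructor
    · rw [lt_div_iff₀ hv]; push_cast; linarith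
    · rw [div_le_iff₀ hv]; push_cast; linarith
  rw [this]; rfl

/-- The effect of one step of `DH 3`, split by the kind of bin receiving the item. -/
theorem dhStep_cases (x v : ℚ) (st : DHState) (hv : v < 1) :
    (∃ l₁ a l₂, st.crit = l₁ ++ a :: l₂ ∧ a.1 = false ∧ x ≤ v ∧
      dhStep 3 x st v =
        { st with crit := l₁ ++ (true, a.2.1 + v, a.2.2 + (v - x)) :: l₂ }) ∨
    ((x ≤ v → ∀ b ∈ st.crit, b.1 = true) ∧
      ((∃ t : ℕ, (t = 2 ∧ 1 / 2 ≤ v ∨ t = 3 ∧ 1 / 3 ≤ v ∧ v < 1 / 2) ∧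
        ((1 ≤ st.bins t + v ∧ dhStep 3 x st v =
            { st with bins := Function.update st.bins t 0, count := st.count + 1 }) ∨
          (st.bins t + v < 1 ∧ dhStep 3 x st v =
            { st with bins := Function.update st.bins t (st.bins t + v) }))) ∨
      (v < 1 / 3 ∧
        ((∃ l₁ a l₂, st.crit = l₁ ++ a :: l₂ ∧ a.2.2 < 1 ∧ dhStep 3 x st v =
            { st with crit := l₁ ++ (a.1, a.2.1 + v, a.2.2 + v) :: l₂ }) ∨
          ((∀ b ∈ st.crit, 1 ≤ b.2.2) ∧
            ((1 ≤ st.small + v ∧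
                dhStep 3 x st v = { st with small := 0, count := st.count + 1 }) ∨
              (st.small + v < 1 ∧ dhStep 3 x st v = { st with small := st.small + v }))))))) := by
  unfold dhStep
  split_ifs with h1 h2 h3 h4
  · obtain ⟨l₁, a, l₂, ha, hb, hc⟩ := updateFirst_eq_append (fun c : Bool × ℚ × ℚ => !c.1)
      (fun c => (true, c.2.1 + v, c.2.2 + (v - x))) st.crit h1.2
    exact Or.inl ⟨l₁, a, l₂, ha, by simpa using hb, h1.1, by rw [hc]⟩
  all_goals
    have hf : x ≤ v → ∀ b ∈ st.crit, b.1 = true := by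
      intro hx b hb
      by_contra hn
      exact h1 ⟨hx, List.any_eq_true.2 ⟨b, hb, by simpa using hn⟩⟩
    refine Or.inr ⟨hf, ?_⟩
  · left
    push_cast at h2
    by_cases h : 1 / 2 ≤ v
    · refine ⟨2, Or.inl ⟨rfl, h⟩, ?_⟩
      rw [toNat_ceil_two h hv]
      dsimp only
      split_ifs with h3
      · exact Or.inl ⟨h3, rfl⟩
      · exact Or.inr ⟨not_le.1 h3, rfl⟩
    · refine ⟨3, Or.inr ⟨rfl, h2, not_le.1 h⟩, ?_⟩
      rw [toNat_ceil_three h2 (not_le.1 h)]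
      dsimp only
      split_ifs with h3
      · exact Or.inl ⟨h3, rfl⟩
      · exact Or.inr ⟨not_le.1 h3, rfl⟩
  all_goals
    push_cast at h2
    refine Or.inr ⟨not_le.1 h2, ?_⟩
  · left
    obtain ⟨l₁, a, l₂, ha, hb, hc⟩ :=
      updateFirst_eq_append (fun c : Bool × ℚ × ℚ => decide (c.2.2 < 1))
        (fun c => (c.1, c.2.1 + v, c.2.2 + v)) st.crit h3
    exact ⟨l₁, a, l₂, ha, by simpa using hb, by rw [hc]⟩
  all_goals
    refine Or.inr ⟨fun b hb => ?_, ?_⟩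
    · by_contra hn
      exact h3 (List.any_eq_true.2 ⟨b, hb, by simpa using hn⟩)
  · exact Or.inl ⟨h4, rfl⟩
  · exact Or.inr ⟨not_le.1 h4, rfl⟩

/-- The invariant kept by `DH 3`: `p` is the list of items read so far, `κ` weighs the small items,
and `t` is a truncated size that is at most `e` on small items. -/
structure RunInv (m : ℕ) (x κ e : ℚ) (t : ℚ → ℚ) (p : List ℚ) (st : DHState) : Prop where
  length : st.crit.length = m
  flags : (∀ b ∈ st.crit, b.1 = true) ∨ p.countP (fun v => x ≤ v) ≤ st.crit.countP (·.1)
  virt : ∀ b ∈ st.crit, b.2.2 = if b.1 then b.2.1 else b.2.1 + x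
  bins_two : st.bins 2 < 1
  bins_three : st.bins 3 < 1
  small : st.small < 1
  weight : ∃ a₂ a₃ : ℕ, (a₂ : ℚ) / 2 ≤ st.bins 2 ∧ (a₃ : ℚ) / 3 ≤ st.bins 3 ∧
    (p.map (itemWeight κ)).sum ≤ st.count + (st.crit.countP (·.1) : ℚ) / 2 +
      κ * (st.crit.map (critBound x (1 / 3))).sum + a₂ / 2 + a₃ / 3 + κ * st.small
  trunc : (∀ b ∈ st.crit, 1 ≤ b.2.2) ∨
    (p.map t).sum ≤ (st.crit.map (critBound x e)).sum

theorem critBound_add_large {x e v : ℚ} (he : 0 ≤ e) (hv : x ≤ v) (a : Bool × ℚ × ℚ) (b : Bool)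
    (y : ℚ) : critBound x e a ≤ critBound x e (b, y, a.2.2 + (v - x)) := by
  unfold critBound
  split_ifs <;> simp only [] at * <;> linarith

theorem critBound_add_small {x e v w : ℚ} (hwv : w ≤ v) (hw : w ≤ e) (a : Bool × ℚ × ℚ)
    (ha : a.2.2 < 1) (b : Bool) (y : ℚ) :
    critBound x e a + w ≤ critBound x e (b, y, a.2.2 + v) := by
  unfold critBound
  split_ifs <;> simp only [] at * <;> linarith

theorem RunInv.step {m : ℕ} {x κ e : ℚ} {t : ℚ → ℚ} {p : List ℚ} {st : DHState}
    (h : RunInv m x κ e t p st) (hx : 1 / 2 ≤ x) (hκ : 0 ≤ κ) (hκ' : κ ≤ 3 / 4) (he : 0 ≤ e)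
    {v : ℚ} (hv : 0 < v) (hv' : v < 1) (htv : t v ≤ v) (hte : t v ≤ e)
    (ht : 1 / 3 ≤ v → t v = 0) : RunInv m x κ e t (p ++ [v]) (dhStep 3 x st v) := by
  obtain ⟨hlen, hfl, hvirt, hb2, hb3, hsm, ⟨a₂, a₃, ha₂, ha₃, hw⟩, htr⟩ := h
  rcases dhStep_cases x v st hv' with ⟨l₁, a, l₂, hc, hf, hxv, hs⟩ |
    ⟨hflag, ⟨s, hs, hstep⟩ | ⟨hv3, ⟨l₁, a, l₂, hc, hav, hs⟩ | ⟨hall, hstep⟩⟩⟩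
  · have hmono : ∀ e', 0 ≤ e' → critBound x e' a ≤
        critBound x e' (true, a.2.1 + v, a.2.2 + (v - x)) := fun e' he' =>
      critBound_add_large he' hxv a _ _
    rw [hs]
    rw [hc] at hlen hfl hvirt hw htr
    refine ⟨?_, ?_, ?_, hb2, hb3, hsm, ⟨a₂, a₃, ha₂, ha₃, ?_⟩, ?_⟩
    · simpa using hlen
    · rcases hfl with hfl | hfl
      · have := hfl a (by simp)
        simp [hf] at this
      · right
        simp [List.countP_append, hf, hxv] at hfl ⊢
        omega
    · intro b hb
      simp only [List.mem_append, List.mem_cons] at hb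
      rcases hb with hb | rfl | hb
      · exact hvirt b (by simp [hb])
      · have := hvirt a (by simp)
        simp [hf] at this ⊢
        linarith
      · exact hvirt b (by simp [hb])
    · have hwv : itemWeight κ v = 1 / 2 := by
        unfold itemWeight; rw [if_pos (hx.trans hxv)]
      have := mul_le_mul_of_nonneg_left (hmono (1 / 3) (by norm_num)) hκ
      simp [List.countP_append, hf, hwv, mul_add] at hw this ⊢
      linarith
    · rcases htr with htr | htr
      · left
        intro b hb
        simp only [List.mem_append, List.mem_cons] at hb
        rcases hb with hb | rfl | hb
        · exact htr b (by simp [hb])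
        · have := htr a (by simp)
          simp only
          linarith
        · exact htr b (by simp [hb])
      · right
        have := hmono e he
        have := ht (by linarith)
        simp at htr ⊢
        linarith
  all_goals
    have hfl' : (∀ b ∈ st.crit, b.1 = true) ∨
        (p ++ [v]).countP (fun v => x ≤ v) ≤ st.crit.countP (·.1) := by
      by_cases hxv : x ≤ v
      · exact Or.inl (hflag hxv)
      · simpa [List.countP_append, hxv] using hfl
  · have hv3 : 1 / 3 ≤ v := by rcases hs with ⟨-, hs⟩ | ⟨-, hs, -⟩ <;> linarith
    have htr' : (∀ b ∈ st.crit, 1 ≤ b.2.2) ∨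
        ((p ++ [v]).map t).sum ≤ (st.crit.map (critBound x e)).sum := by
      simpa [ht hv3] using htr
    rcases hs with ⟨rfl, hv2⟩ | ⟨rfl, -, hv2⟩
    · have hwv : itemWeight κ v = 1 / 2 := by unfold itemWeight; rw [if_pos hv2]
      rcases hstep with ⟨h1, hs⟩ | ⟨h1, hs⟩ <;> rw [hs]
      · have h2 : (a₂ : ℚ) < (2 : ℕ) := by push_cast; linarith
        have h2 : (a₂ : ℚ) ≤ 1 := by
          have := Nat.lt_succ_iff.1 (Nat.cast_lt.1 h2)
          exact_mod_cast this
        refine ⟨hlen, hfl', hvirt, by simp, by simpa using hb3, hsm,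
          ⟨0, a₃, by simp, by simpa using ha₃, ?_⟩, htr'⟩
        simp [hwv] at hw ⊢
        linarith
      · refine ⟨hlen, hfl', hvirt, by simpa using h1, by simpa using hb3, hsm,
          ⟨a₂ + 1, a₃, by simp; linarith, by simpa using ha₃, ?_⟩, htr'⟩
        simp [hwv] at hw ⊢
        linarith
    · have hwv : itemWeight κ v = 1 / 3 := by
        unfold itemWeight; rw [if_neg (not_le.2 hv2), if_pos hv3]
      rcases hstep with ⟨h1, hs⟩ | ⟨h1, hs⟩ <;> rw [hs]
      · have h2 : (a₃ : ℚ) < (3 : ℕ) := by push_cast; linarith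
        have h2 : (a₃ : ℚ) ≤ 2 := by
          have := Nat.lt_succ_iff.1 (Nat.cast_lt.1 h2)
          exact_mod_cast this
        refine ⟨hlen, hfl', hvirt, by simpa using hb2, by simp, hsm,
          ⟨a₂, 0, by simpa using ha₂, by simp, ?_⟩, htr'⟩
        simp [hwv] at hw ⊢
        linarith
      · refine ⟨hlen, hfl', hvirt, by simpa using hb2, by simpa using h1, hsm,
          ⟨a₂, a₃ + 1, by simpa using ha₂, by simp; linarith, ?_⟩, htr'⟩
        simp [hwv] at hw ⊢
        linarith
  · have hwv : itemWeight κ v = κ * v := by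
      unfold itemWeight; rw [if_neg (by linarith), if_neg (by linarith)]
    rw [hs]
    rw [hc] at hlen hfl' hvirt hw htr
    refine ⟨?_, ?_, ?_, hb2, hb3, hsm, ⟨a₂, a₃, ha₂, ha₃, ?_⟩, ?_⟩
    · simpa using hlen
    · rcases hfl' with hfl | hfl
      · left
        intro b hb
        simp only [List.mem_append, List.mem_cons] at hb
        rcases hb with hb | rfl | hb
        · exact hfl b (by simp [hb])
        · exact hfl a (by simp)
        · exact hfl b (by simp [hb])
      · right
        simpa [List.countP_append, List.countP_cons] using hfl
    · intro b hb
      simp only [List.mem_append, List.mem_cons] at hb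
      rcases hb with hb | rfl | hb
      · exact hvirt b (by simp [hb])
      · have := hvirt a (by simp)
        simp only [this]
        split_ifs <;> ring
      · exact hvirt b (by simp [hb])
    · have := mul_le_mul_of_nonneg_left
        (critBound_add_small (x := x) (e := 1 / 3) le_rfl hv3.le a hav a.1 (a.2.1 + v)) hκ
      simp [List.countP_append, List.countP_cons, hwv, mul_add] at hw this ⊢
      linarith
    · rcases htr with htr | htr
      · have := htr a (by simp)
        linarith
      · right
        have := critBound_add_small (x := x) htv hte a hav a.1 (a.2.1 + v)
        simp at htr ⊢
        linarith
  · have hwv : itemWeight κ v = κ * v := by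
      unfold itemWeight; rw [if_neg (by linarith), if_neg (by linarith)]
    rcases hstep with ⟨h1, hs⟩ | ⟨h1, hs⟩ <;> rw [hs]
    · refine ⟨hlen, hfl', hvirt, hb2, hb3, by simp, ⟨a₂, a₃, ha₂, ha₃, ?_⟩, Or.inl hall⟩
      have : κ * (st.small + v) ≤ 1 := by nlinarith
      simp [hwv] at hw ⊢
      linarith
    · refine ⟨hlen, hfl', hvirt, hb2, hb3, h1, ⟨a₂, a₃, ha₂, ha₃, ?_⟩, Or.inl hall⟩
      simp [hwv, mul_add] at hw ⊢
      linarith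

theorem RunInv.foldl {m : ℕ} {x κ e : ℚ} {t : ℚ → ℚ} (hx : 1 / 2 ≤ x)
    (hκ : 0 ≤ κ) (hκ' : κ ≤ 3 / 4) (he : 0 ≤ e) (hmx : m = 0 ∨ x < 1) (σ : List ℚ)
    (hσ : ∀ v ∈ σ, 0 < v ∧ v < 1) (ht : ∀ v ∈ σ, t v ≤ v ∧ t v ≤ e ∧ (1 / 3 ≤ v → t v = 0)) :
    RunInv m x κ e t σ (σ.foldl (dhStep 3 x)
      ⟨List.replicate m (false, (0 : ℚ), x), fun _ => 0, 0, 0⟩) := by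
  induction σ using List.reverseRecOn with
  | nil =>
    have h0 : ∀ e', (List.replicate m (critBound x e' (false, 0, x))).sum = 0 := by
      intro e'
      rcases hmx with rfl | hlt
      · simp
      · simp [critBound, hlt]
    refine ⟨by simp, Or.inr (by simp), ?_, by simp, by simp, by simp,
      ⟨0, 0, by simp, by simp, ?_⟩, Or.inr ?_⟩
    · intro b hb
      rw [List.eq_of_mem_replicate hb]
      simp
    · simp only [List.foldl_nil, List.map_replicate, h0]
      simp [List.countP_replicate]
    · simp only [List.foldl_nil, List.map_replicate, h0]
      simp
  | append_singleton p v ih =>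
    rw [List.foldl_append]
    have hv := hσ v (by simp)
    have htv := ht v (by simp)
    exact (ih (fun v hv => hσ v (by simp [hv])) (fun v hv => ht v (by simp [hv]))).step
      hx hκ hκ' he hv.1 hv.2 htv.1 htv.2.1 htv.2.2

theorem sum_critBound_le {x e : ℚ} (he : 0 ≤ e) (l : List (Bool × ℚ × ℚ)) :
    (l.map (critBound x e)).sum ≤ l.length * (1 - x + e) := by
  have := List.sum_le_card_nsmul (l.map (critBound x e)) (1 - x + e) (by
    intro y hy
    obtain ⟨b, -, rfl⟩ := List.mem_map.1 hy
    unfold critBound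
    split_ifs <;> linarith)
  rwa [List.length_map, nsmul_eq_mul] at this

theorem sum_critBound_lt {x e : ℚ} (he : 0 < e) (l : List (Bool × ℚ × ℚ)) {b : Bool × ℚ × ℚ}
    (hb : b ∈ l) (hb' : b.2.2 < 1) :
    (l.map (critBound x e)).sum < l.length * (1 - x + e) := by
  obtain ⟨l₁, l₂, rfl⟩ := List.append_of_mem hb
  have h₁ := sum_critBound_le (x := x) he.le l₁
  have h₂ := sum_critBound_le (x := x) he.le l₂
  have h₃ : critBound x e b < 1 - x + e := by
    unfold critBound
    rw [if_pos hb']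
    linarith
  simp [add_mul] at h₁ h₂ ⊢
  linarith

/-- If there are enough items of size at least `x` and enough (truncated) small items, `DH 3` covers
all critical bins, and the total weight of the items bounds the number of covered bins. -/
theorem weight_le_DH {m : ℕ} {x κ : ℚ} (hx : 1 / 2 ≤ x) (hx' : x ≤ 1) (hmx : m = 0 ∨ x < 1)
    (hκ : 0 ≤ κ) (hκ' : κ ≤ 3 / 4) (σ : List ℚ) (hσ : ∀ v ∈ σ, 0 < v ∧ v < 1)
    (hm : m ≤ σ.countP (fun v => x ≤ v))
    (hT : m * (1 - x + min (1 - x) (1 / 3)) ≤ (σ.map (truncSize (1 - x))).sum) :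
    (σ.map (itemWeight κ)).sum + m / 2 - κ * (m * (4 / 3 - x)) - 7 / 6 - κ ≤ DH 3 m x σ := by
  have he : 0 ≤ min (1 - x) (1 / 3) := le_min (by linarith) (by norm_num)
  have ht : ∀ v ∈ σ, truncSize (1 - x) v ≤ v ∧ truncSize (1 - x) v ≤ min (1 - x) (1 / 3) ∧
      (1 / 3 ≤ v → truncSize (1 - x) v = 0) := by
    intro v hv
    unfold truncSize
    have := hσ v hv
    split_ifs with h
    · exact ⟨min_le_left _ _, le_min (min_le_right _ _) ((min_le_left _ _).trans h.le),
        fun h' => absurd h (not_lt.2 h')⟩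
    · exact ⟨this.1.le, he, fun _ => rfl⟩
  obtain ⟨hlen, hfl, hvirt, hb2, hb3, hsm, ⟨a₂, a₃, ha₂, ha₃, hw⟩, htr⟩ :=
    RunInv.foldl hx hκ hκ' he hmx σ hσ ht
  unfold DH
  set st := σ.foldl (dhStep 3 x) ⟨List.replicate m (false, (0 : ℚ), x), fun _ => 0, 0, 0⟩
  have hflags : ∀ b ∈ st.crit, b.1 = true := by
    rcases hfl with hfl | hfl
    · exact hfl
    · refine List.countP_eq_length.1 (le_antisymm List.countP_le_length ?_)
      exact hlen.trans_le (hm.trans hfl)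
  have hfull : ∀ b ∈ st.crit, 1 ≤ b.2.2 := by
    rcases htr with htr | htr
    · exact htr
    · intro b hb
      by_contra hn
      have hm0 : x < 1 := by
        rcases hmx with rfl | h
        · rw [List.length_eq_zero_iff.1 hlen] at hb
          simp at hb
        · exact h
      have := sum_critBound_lt (x := x) (lt_min (sub_pos.2 hm0) (by norm_num : (0 : ℚ) < 1 / 3)) _ hb
        (not_le.1 hn)
      rw [hlen] at this
      linarith
  have hcov : st.crit.countP (fun c => decide (1 ≤ c.2.1)) = m := by
    rw [← hlen]
    refine List.countP_eq_length.2 fun b hb => ?_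
    have h1 := hvirt b hb
    rw [if_pos (hflags b hb)] at h1
    simpa [← h1] using hfull b hb
  have hcnt : ((st.crit.countP (·.1) : ℕ) : ℚ) ≤ m := by
    rw [← hlen]
    exact_mod_cast List.countP_le_length
  have hsum := mul_le_mul_of_nonneg_left
    (sum_critBound_le (x := x) (by norm_num : (0 : ℚ) ≤ 1 / 3) st.crit) hκ
  rw [hlen] at hsum
  have hs := mul_le_mul_of_nonneg_left hsm.le hκ
  have h2 : (a₂ : ℚ) ≤ 1 := by
    have : (a₂ : ℚ) < (2 : ℕ) := by push_cast; linarith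
    have := Nat.lt_succ_iff.1 (Nat.cast_lt.1 this)
    exact_mod_cast this
  have h3 : (a₃ : ℚ) ≤ 2 := by
    have : (a₃ : ℚ) < (3 : ℕ) := by push_cast; linarith
    have := Nat.lt_succ_iff.1 (Nat.cast_lt.1 this)
    exact_mod_cast this
  simp only [hcov]
  push_cast
  nlinarith

/-- The size of a small item; items that are not small count `0`. -/
def smallSize (v : ℚ) : ℚ := if v < 1 / 3 then v else 0

/-- The number of `2`-items in a bin. -/
def numTwo (B : Multiset ℚ) : ℕ := B.countP (fun v => 1 / 2 ≤ v)

/-- The number of `3`-items in a bin. -/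
def numThree (B : Multiset ℚ) : ℕ := B.countP (fun v => 1 / 3 ≤ v ∧ v < 1 / 2)

/-- The total size of the `2`-items in a bin. -/
def sumTwo (B : Multiset ℚ) : ℚ := (B.filter (fun v => 1 / 2 ≤ v)).sum

/-- The bin is covered by one `2`-item together with small items. -/
def IsLargeSmall (B : Multiset ℚ) : Prop := 1 ≤ B.sum ∧ numTwo B = 1 ∧ numThree B = 0

instance : DecidablePred IsLargeSmall := fun B =>
  inferInstanceAs (Decidable (1 ≤ B.sum ∧ numTwo B = 1 ∧ numThree B = 0))

/-- The reserve of a covered bin without `2`-items: an amount of small items that the bin is certain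
to contain and needs for its weight to reach `9/14`. -/
def reserve (B : Multiset ℚ) : ℚ :=
  if 1 ≤ B.sum ∧ numTwo B = 0 then
    if numThree B = 0 then 1 else if numThree B = 1 then 1 / 2 else 0
  else 0

theorem reserve_nonneg (B : Multiset ℚ) : 0 ≤ reserve B := by
  unfold reserve
  split_ifs <;> norm_num

theorem sum_itemWeight (κ : ℚ) (B : Multiset ℚ) :
    (B.map (itemWeight κ)).sum =
      (numTwo B : ℚ) / 2 + (numThree B : ℚ) / 3 + κ * (B.map smallSize).sum := by
  unfold numTwo numThree
  induction B using Multiset.induction with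
  | empty => simp
  | cons v B ih =>
    rw [Multiset.map_cons, Multiset.sum_cons, Multiset.map_cons, Multiset.sum_cons,
      Multiset.countP_cons, Multiset.countP_cons, ih]
    rw [itemWeight, smallSize]
    push_cast
    split_ifs <;> first | (exfalso; grind) | ring

theorem sum_le_sumTwo_add (B : Multiset ℚ) :
    B.sum ≤ sumTwo B + (numThree B : ℚ) / 2 + (B.map smallSize).sum := by
  unfold sumTwo numThree
  induction B using Multiset.induction with
  | empty => simp
  | cons v B ih =>
    rw [Multiset.sum_cons, Multiset.map_cons, Multiset.sum_cons, Multiset.countP_cons,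
      Multiset.filter_cons, Multiset.sum_add]
    rw [smallSize]
    push_cast
    split_ifs <;> simp only [Multiset.sum_singleton, Multiset.sum_zero] <;> grind

theorem exists_of_numTwo_eq_one {B : Multiset ℚ} (h : numTwo B = 1) :
    ∃ v ∈ B, 1 / 2 ≤ v ∧ sumTwo B = v := by
  unfold numTwo at h
  rw [Multiset.countP_eq_card_filter, Multiset.card_eq_one] at h
  obtain ⟨v, hv⟩ := h
  have hmem : v ∈ B.filter (fun v => 1 / 2 ≤ v) := by rw [hv]; simp
  rw [Multiset.mem_filter] at hmem
  exact ⟨v, hmem.1, hmem.2, by unfold sumTwo; rw [hv, Multiset.sum_singleton]⟩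

theorem sumTwo_of_numTwo_eq_zero {B : Multiset ℚ} (h : numTwo B = 0) : sumTwo B = 0 := by
  unfold numTwo at h
  rw [Multiset.countP_eq_card_filter, Multiset.card_eq_zero] at h
  unfold sumTwo
  rw [h, Multiset.sum_zero]

theorem sum_smallSize_nonneg {B : Multiset ℚ} (hB : ∀ v ∈ B, 0 < v) :
    0 ≤ (B.map smallSize).sum := by
  refine Multiset.sum_nonneg fun y hy => ?_
  obtain ⟨v, hv, rfl⟩ := Multiset.mem_map.1 hy
  have := hB v hv
  unfold smallSize
  split_ifs <;> linarith

theorem mul_sum_smallSize_le {B : Multiset ℚ} (hB : ∀ v ∈ B, 0 < v) {c : ℚ} (hc : 0 ≤ c) :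
    3 * min c (1 / 3) * (B.map smallSize).sum ≤ (B.map (truncSize c)).sum := by
  rw [← Multiset.sum_map_mul_left]
  refine Multiset.sum_map_le_sum_map _ _ fun v hv => ?_
  have hv := hB v hv
  unfold smallSize truncSize
  have h₁ : min c (1 / 3) ≤ c := min_le_left _ _
  have h₂ : min c (1 / 3) ≤ 1 / 3 := min_le_right _ _
  split_ifs with h
  · refine le_min ?_ ?_
    · nlinarith
    · nlinarith [le_min hc (by norm_num : (0 : ℚ) ≤ 1 / 3)]
  · simp

theorem min_sum_smallSize_le {B : Multiset ℚ} (hB : ∀ v ∈ B, 0 < v) {c : ℚ} (hc : 0 ≤ c) :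
    min c (B.map smallSize).sum ≤ (B.map (truncSize c)).sum := by
  induction B using Multiset.induction with
  | empty => simp
  | cons v B ih =>
    have h₁ := ih fun w hw => hB w (by simp [hw])
    have h₂ := sum_smallSize_nonneg (B := B) fun w hw => hB w (by simp [hw])
    have hv := hB v (by simp)
    rw [Multiset.map_cons, Multiset.sum_cons, Multiset.map_cons, Multiset.sum_cons]
    rw [truncSize, smallSize]
    split_ifs <;> grind

theorem weight_of_bin (B : Multiset ℚ) :
    9 / 14 * (if 1 ≤ B.sum then 1 else 0) ≤
      (numTwo B : ℚ) / 2 + (numThree B : ℚ) / 3 + 9 / 14 * reserve B +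
        1 / 7 * (if IsLargeSmall B then 1 else 0) := by
  have hn2 : (0 : ℚ) ≤ numTwo B := Nat.cast_nonneg _
  have hn3 : (0 : ℚ) ≤ numThree B := Nat.cast_nonneg _
  by_cases h : 1 ≤ B.sum
  · obtain h2 | h2 | h2 : numTwo B = 0 ∨ numTwo B = 1 ∨ 2 ≤ numTwo B := by omega
    · obtain h3 | h3 | h3 : numThree B = 0 ∨ numThree B = 1 ∨ 2 ≤ numThree B := by omega
      · simp [reserve, IsLargeSmall, h, h2, h3]
      · simp [reserve, IsLargeSmall, h, h2, h3]; norm_num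
      · have h3' : (2 : ℚ) ≤ numThree B := by exact_mod_cast h3
        have hne : numThree B ≠ 0 ∧ numThree B ≠ 1 := by omega
        simp [reserve, IsLargeSmall, h, h2, hne]
        linarith
    · obtain h3 | h3 : numThree B = 0 ∨ 1 ≤ numThree B := by omega
      · simp [reserve, IsLargeSmall, h, h2, h3]; norm_num
      · have h3' : (1 : ℚ) ≤ numThree B := by exact_mod_cast h3
        have hne : numThree B ≠ 0 := by omega
        simp [reserve, IsLargeSmall, h, h2, hne]
        linarith
    · have h2' : (2 : ℚ) ≤ numTwo B := by exact_mod_cast h2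
      have hne : numTwo B ≠ 0 ∧ numTwo B ≠ 1 := by omega
      simp [reserve, IsLargeSmall, h, hne]
      linarith
  · simp [reserve, IsLargeSmall, h]
    positivity

theorem reserve_le {B : Multiset ℚ} (hB : ∀ v ∈ B, 0 < v) :
    reserve B ≤ (B.map smallSize).sum := by
  have h0 := sum_smallSize_nonneg hB
  have h1 := sum_le_sumTwo_add B
  unfold reserve
  split_ifs with h h3 h3
  · rw [sumTwo_of_numTwo_eq_zero h.2, h3] at h1
    simp at h1
    linarith
  · rw [sumTwo_of_numTwo_eq_zero h.2, h3] at h1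
    simp at h1
    linarith
  · exact h0
  · exact h0

theorem IsLargeSmall.reserve_eq_zero {B : Multiset ℚ} (h : IsLargeSmall B) : reserve B = 0 := by
  unfold reserve
  rw [if_neg]
  rintro ⟨-, h'⟩
  rw [h.2.1] at h'
  exact one_ne_zero h'

theorem IsLargeSmall.le_sum_smallSize {B : Multiset ℚ} (h : IsLargeSmall B) :
    1 - sumTwo B ≤ (B.map smallSize).sum := by
  have h1 := sum_le_sumTwo_add B
  rw [h.2.2] at h1
  have := h.1
  simp at h1
  linarith

theorem small_of_bin {B : Multiset ℚ} (hB : ∀ v ∈ B, 0 < v) :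
    reserve B + (if IsLargeSmall B then 1 - sumTwo B else 0) ≤ (B.map smallSize).sum := by
  split_ifs with h
  · rw [h.reserve_eq_zero, zero_add]
    exact h.le_sum_smallSize
  · rw [add_zero]
    exact reserve_le hB

theorem trunc_of_bin {B : Multiset ℚ} (hB : ∀ v ∈ B, 0 < v) {c : ℚ} (hc : 0 ≤ c) :
    3 * min c (1 / 3) * reserve B + (if IsLargeSmall B then min c (1 - sumTwo B) else 0) ≤
      (B.map (truncSize c)).sum := by
  split_ifs with h
  · rw [h.reserve_eq_zero, mul_zero, zero_add]
    exact (min_le_min_left c h.le_sum_smallSize).trans (min_sum_smallSize_le hB hc)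
  · rw [add_zero]
    refine le_trans ?_ (mul_sum_smallSize_le hB hc)
    exact mul_le_mul_of_nonneg_left (reserve_le hB)
      (mul_nonneg (by norm_num) (le_min hc (by norm_num)))

theorem large_of_bin (B : Multiset ℚ) (x : ℚ) :
    (if IsLargeSmall B then (if x ≤ sumTwo B then 1 else 0) else 0) ≤
      B.countP (fun v => x ≤ v) := by
  split_ifs with h hx
  · obtain ⟨v, hv, -, hs⟩ := exists_of_numTwo_eq_one h.2.1
    exact Multiset.countP_pos.2 ⟨v, hv, hs ▸ hx⟩
  · exact Nat.zero_le _
  · exact Nat.zero_le _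

/-- Choice of the threshold as the `m`-th largest element of `D`. -/
theorem exists_threshold (D : Multiset ℚ) (hD : ∀ y ∈ D, 1 / 2 ≤ y ∧ y < 1) {m : ℕ}
    (hm : m ≤ D.card) :
    ∃ x : ℚ, 1 / 2 ≤ x ∧ x ≤ 1 ∧ (m = 0 ∨ x < 1) ∧ m ≤ D.countP (fun y => x ≤ y) ∧
      ((D.card : ℚ) - m) * (1 - x) ≤ (D.map (fun y => min (1 - x) (1 - y))).sum := by
  rcases Nat.eq_zero_or_pos m with rfl | hpos
  · refine ⟨1, by norm_num, le_rfl, Or.inl rfl, Nat.zero_le _, ?_⟩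
    simp only [sub_self, mul_zero]
    refine Multiset.sum_nonneg fun y hy => ?_
    obtain ⟨v, hv, rfl⟩ := Multiset.mem_map.1 hy
    exact le_min le_rfl (by linarith [(hD v hv).2])
  · obtain ⟨l, hl, rfl⟩ : ∃ l : List ℚ, l.Pairwise (· ≤ ·) ∧ (l : Multiset ℚ) = D :=
      ⟨D.sort (· ≤ ·), D.pairwise_sort _, D.sort_eq _⟩
    rw [Multiset.coe_card] at hm
    have hlt : l.length - m < l.length := by omega
    obtain ⟨A, x, B, rfl, hA⟩ : ∃ A x B, l = A ++ x :: B ∧ A.length = l.length - m :=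
      ⟨l.take (l.length - m), l[l.length - m], l.drop (l.length - m + 1), by
        rw [← List.drop_eq_getElem_cons hlt, List.take_append_drop], by simp⟩
    rw [List.pairwise_append, List.pairwise_cons] at hl
    obtain ⟨-, ⟨hB, -⟩, hAB⟩ := hl
    have hx := hD x (by simp)
    have hlen : B.length + 1 = m := by
      simp at hA hm
      omega
    refine ⟨x, hx.1, hx.2.le, Or.inr hx.2, ?_, ?_⟩
    · have : (x :: B).countP (fun y => decide (x ≤ y)) = (x :: B).length := by
        refine List.countP_eq_length.2 fun b hb => ?_
        rcases List.mem_cons.1 hb with rfl | hb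
        · simp
        · simpa using hB b hb
      rw [Multiset.coe_countP, List.countP_append, this, List.length_cons, hlen]
      exact Nat.le_add_left _ _
    · have h₁ : (A.length : ℚ) * (1 - x) ≤ (A.map (fun y => min (1 - x) (1 - y))).sum := by
        have := List.card_nsmul_le_sum (A.map (fun y => min (1 - x) (1 - y))) (1 - x) (by
          intro z hz
          obtain ⟨y, hy, rfl⟩ := List.mem_map.1 hz
          exact le_min le_rfl (by linarith [hAB y hy x (by simp)]))
        rwa [List.length_map, nsmul_eq_mul] at this
      have h₂ : 0 ≤ ((x :: B).map (fun y => min (1 - x) (1 - y))).sum := by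
        refine List.sum_nonneg fun z hz => ?_
        obtain ⟨y, hy, rfl⟩ := List.mem_map.1 hz
        exact le_min (by linarith)
          (by linarith [(hD y (by simp at hy ⊢; tauto)).2])
      rw [Multiset.map_coe, Multiset.sum_coe, Multiset.coe_card, List.map_append,
        List.sum_append, List.length_append, List.length_cons, ← hlen]
      push_cast
      have : ((A.length : ℚ) + (B.length + 1) - (B.length + 1)) * (1 - x) =
        A.length * (1 - x) := by ring
      linarith

theorem sum_map_sum {α : Type*} (f : α → ℚ) (P : Multiset (Multiset α)) :
    (P.sum.map f).sum = (P.map fun B => (B.map f).sum).sum := by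
  induction P using Multiset.induction with
  | empty => simp
  | cons B P ih => simp [ih]

theorem sum_map_ite_zero {α M : Type*} [AddCommMonoid M] (p : α → Prop) [DecidablePred p]
    (f : α → M) (P : Multiset α) :
    (P.map fun B => if p B then f B else 0).sum = ((P.filter p).map f).sum := by
  induction P using Multiset.induction with
  | empty => simp
  | cons B P ih =>
    by_cases h : p B <;> simp [h, ih]

theorem countP_sum (x : ℚ) (P : Multiset (Multiset ℚ)) :
    P.sum.countP (fun v => x ≤ v) = (P.map fun B => B.countP (fun v => x ≤ v)).sum := by
  induction P using Multiset.induction with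
  | empty => simp
  | cons B P ih => simp [ih]

/-- The advice obtained from a fixed covering `P`. -/
theorem exists_advice (σ : List ℚ) (hσ : ∀ v ∈ σ, 0 < v ∧ v < 1) (P : Multiset (Multiset ℚ))
    (hP : P.sum = ↑σ) :
    ∃ m ≤ σ.length, ∃ x : ℚ, 1 / 2 ≤ x ∧ x ≤ 1 ∧
      (9 / 14 : ℚ) * (coveredCount P : ℚ) - 97 / 42 ≤ (DH 3 m x σ : ℚ) := by
  have hB : ∀ B ∈ P, ∀ v ∈ B, 0 < v ∧ v < 1 := by
    intro B hB v hv
    have : v ∈ P.sum := Multiset.mem_of_le (Multiset.le_sum_of_mem hB) hv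
    rw [hP] at this
    exact hσ v this
  have hsum : ∀ f : ℚ → ℚ, (σ.map f).sum = (P.map fun B => (B.map f).sum).sum := by
    intro f
    rw [← sum_map_sum, hP]
    simp
  set D : Multiset ℚ := (P.filter IsLargeSmall).map sumTwo with hDdef
  set N : ℚ := (D.card : ℚ) with hN
  set R : ℚ := (P.map reserve).sum with hR
  have hD : ∀ y ∈ D, 1 / 2 ≤ y ∧ y < 1 := by
    intro y hy
    obtain ⟨B, hBm, rfl⟩ := Multiset.mem_map.1 hy
    rw [Multiset.mem_filter] at hBm
    obtain ⟨v, hv, hv2, hs⟩ := exists_of_numTwo_eq_one hBm.2.2.1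
    rw [hs]
    exact ⟨hv2, (hB B hBm.1 v hv).2⟩
  have hR0 : 0 ≤ R := by
    refine Multiset.sum_nonneg fun y hy => ?_
    obtain ⟨B, -, rfl⟩ := Multiset.mem_map.1 hy
    exact reserve_nonneg B
  have hN0 : 0 ≤ N := Nat.cast_nonneg _
  set z : ℚ := min ((2 * N + 9 * R) / 7) ((4 * N - 3 * R) / 7) with hz
  set m : ℕ := ⌊z⌋₊ with hmdef
  have hzm : z < m + 1 := Nat.lt_floor_add_one z
  have hm : 2 * (m : ℚ) ≤ N ∧ 3 * (m : ℚ) ≤ N + 3 * R := by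
    rcases le_total 0 z with h | h
    · have h₁ : (m : ℚ) ≤ z := Nat.floor_le h
      have h₂ : z ≤ (2 * N + 9 * R) / 7 := min_le_left _ _
      have h₃ : z ≤ (4 * N - 3 * R) / 7 := min_le_right _ _
      constructor <;> linarith
    · have : m = 0 := Nat.floor_of_nonpos h
      rw [this]
      push_cast
      constructor <;> linarith
  have hmD : m ≤ D.card := by
    have : (m : ℚ) ≤ D.card := by
      have : (0 : ℚ) ≤ m := Nat.cast_nonneg _
      linarith [hm.1]
    exact_mod_cast this
  obtain ⟨x, hx, hx', hmx, hmc, hxs⟩ := exists_threshold D hD hmD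
  have hc : 0 ≤ 1 - x := by linarith
  have hL : m ≤ σ.countP (fun v => x ≤ v) := by
    refine hmc.trans ?_
    have h₁ : σ.countP (fun v => x ≤ v) = (P.map fun B => B.countP (fun v => x ≤ v)).sum := by
      rw [← countP_sum, hP, Multiset.coe_countP]
    have h₂ : D.countP (fun y => x ≤ y) = (P.map fun B =>
        if IsLargeSmall B then (if x ≤ sumTwo B then 1 else 0) else 0).sum := by
      rw [sum_map_ite_zero, hDdef, Multiset.countP_map, sum_map_ite_zero]
      simp
    rw [h₁, h₂]
    exact Multiset.sum_map_le_sum_map _ _ fun B _ => large_of_bin B x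
  have hT : 3 * min (1 - x) (1 / 3) * R + (N - m) * (1 - x) ≤
      (σ.map (truncSize (1 - x))).sum := by
    have h := Multiset.sum_map_le_sum_map _ _ fun B (hBm : B ∈ P) =>
      trunc_of_bin (fun v hv => (hB B hBm v hv).1) hc
    rw [Multiset.sum_map_add, Multiset.sum_map_mul_left, sum_map_ite_zero, ← hsum] at h
    rw [hDdef, Multiset.map_map] at hxs
    refine le_trans (add_le_add_right ?_ _) h
    exact hxs
  have hS : R + (N - m) * (1 - x) ≤ (P.map fun B => (B.map smallSize).sum).sum := by
    have h := Multiset.sum_map_le_sum_map _ _ fun B (hBm : B ∈ P) =>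
      small_of_bin (fun v hv => (hB B hBm v hv).1)
    rw [Multiset.sum_map_add, sum_map_ite_zero] at h
    refine le_trans (add_le_add_right ?_ _) h
    refine hxs.trans ?_
    rw [hDdef, Multiset.map_map]
    exact Multiset.sum_map_le_sum_map _ _ fun B _ => min_le_right _ _
  have hW : 9 / 14 * (coveredCount P : ℚ) ≤
      (P.map fun B => (numTwo B : ℚ) / 2 + (numThree B : ℚ) / 3).sum + 9 / 14 * R +
        1 / 7 * N := by
    have h := Multiset.sum_map_le_sum_map _ _ fun B (_ : B ∈ P) => weight_of_bin B
    rw [Multiset.sum_map_add, Multiset.sum_map_add, Multiset.sum_map_mul_left,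
      Multiset.sum_map_mul_left, Multiset.sum_map_mul_left, sum_map_ite_zero,
      sum_map_ite_zero] at h
    simpa [coveredCount, hN, hDdef] using h
  have hwt : ∀ κ : ℚ, (σ.map (itemWeight κ)).sum =
      (P.map fun B => (numTwo B : ℚ) / 2 + (numThree B : ℚ) / 3).sum +
        κ * (P.map fun B => (B.map smallSize).sum).sum := by
    intro κ
    rw [hsum, ← Multiset.sum_map_mul_left, ← Multiset.sum_map_add]
    simp only [sum_itemWeight]
  have hneed : m * (1 - x + min (1 - x) (1 / 3)) ≤ (σ.map (truncSize (1 - x))).sum := by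
    refine le_trans ?_ hT
    have h₁ : min (1 - x) (1 / 3) ≤ 1 - x := min_le_left _ _
    have h₂ : 0 ≤ min (1 - x) (1 / 3) := le_min hc (by norm_num)
    have h₃ := mul_nonneg (sub_nonneg.2 hm.1) hc
    rcases le_total (m : ℚ) (3 * R) with h | h
    · have := mul_nonneg (sub_nonneg.2 h) h₂
      linarith
    · have h₄ := mul_nonneg (sub_nonneg.2 h) (sub_nonneg.2 h₁)
      have h₅ := mul_nonneg (sub_nonneg.2 hm.2) hc
      linarith
  refine ⟨m, hL.trans List.countP_le_length, x, hx, hx', ?_⟩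
  rcases min_lt_iff.1 hzm with h | h
  · have := weight_le_DH hx hx' hmx le_rfl (by norm_num) σ hσ hL hneed
    rw [hwt] at this
    linarith
  · have := weight_le_DH hx hx' hmx (by norm_num) le_rfl σ hσ hL hneed
    rw [hwt] at this
    have h₃ := mul_nonneg (sub_nonneg.2 hm.1) hc
    linarith

theorem coveredCount_le_sum (P : Multiset (Multiset ℚ)) (hP : ∀ B ∈ P, 0 ≤ B.sum) :
    (coveredCount P : ℚ) ≤ P.sum.sum := by
  unfold coveredCount
  induction P using Multiset.induction with
  | empty => simp
  | cons B P ih =>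
    have h₁ := ih fun C hC => hP C (by simp [hC])
    have h₂ := hP B (by simp)
    by_cases h : 1 ≤ B.sum <;> simp [h] <;> linarith

theorem exists_optimal (σ : List ℚ) (hσ : ∀ v ∈ σ, 0 < v ∧ v < 1) :
    ∃ P : Multiset (Multiset ℚ), P.sum = ↑σ ∧
      ∀ P' : Multiset (Multiset ℚ), P'.sum = ↑σ → coveredCount P' ≤ coveredCount P := by
  set S : Set ℕ := {n | ∃ P : Multiset (Multiset ℚ), P.sum = ↑σ ∧ coveredCount P = n}
  have hne : S.Nonempty := ⟨_, {(σ : Multiset ℚ)}, by simp, rfl⟩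
  have hbdd : BddAbove S := by
    refine ⟨⌊σ.sum⌋₊, ?_⟩
    rintro _ ⟨P, hP, rfl⟩
    refine Nat.le_floor ?_
    have := coveredCount_le_sum P fun B hB => Multiset.sum_nonneg fun v hv => by
      have : v ∈ P.sum := Multiset.mem_of_le (Multiset.le_sum_of_mem hB) hv
      rw [hP] at this
      exact (hσ v this).1.le
    rwa [hP, Multiset.sum_coe] at this
  obtain ⟨P, hP, hPn⟩ := Nat.sSup_mem hne hbdd
  refine ⟨P, hP, fun P' hP' => ?_⟩
  rw [hPn]
  exact le_csSup hbdd ⟨P', hP', rfl⟩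

/-- For every finite list `σ` of rational items in `(0,1)` there is advice
`m ≤ |σ|` and `x ∈ [1/2, 1]` such that `DH₃` with advice `(m, x)` covers at
least `(9/14)·OPT(σ) − 97/42` bins, where the optimum ranges over all partitions
of the multiset of items of `σ` into bins. -/
theorem dh3_nine_fourteenths (σ : List ℚ) (hσ : ∀ v ∈ σ, 0 < v ∧ v < 1) :
    ∃ m ≤ σ.length, ∃ x : ℚ, 1/2 ≤ x ∧ x ≤ 1 ∧
      ∀ P : Multiset (Multiset ℚ), P.sum = ↑σ →
        (9/14 : ℚ) * (coveredCount P : ℚ) - 97/42 ≤ (DH 3 m x σ : ℚ) := by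
  obtain ⟨P₀, hP₀, hmax⟩ := exists_optimal σ hσ
  obtain ⟨m, hm, x, hx, hx', h⟩ := exists_advice σ hσ P₀ hP₀
  refine ⟨m, hm, x, hx, hx', fun P hP => le_trans ?_ h⟩
  have : (coveredCount P : ℚ) ≤ coveredCount P₀ := by exact_mod_cast hmax P hP
  linarith
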